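/- Under the bounded-domain setting (Q a bounded C² domain, reflected controlled diffusion with co-normal reflection, b Lipschitz in x uniformly in ξ, σ ∈ C¹ with Hölder derivatives and a = σσᵀ nondegenerate on Q, c Lipschitz in x uniformly in ξ), the Neumann principal eigenvalue ρ of the operator 𝒢 on Q satisfies the saddle-point identity ρ = inf over g ∈ C²_γ(Q̄) of sup over μ ∈ 𝒫(Q̄×𝒦×ℝᵈ) of F(g,μ) = sup over μ ∈ 𝒫(Q̄×𝒦×ℝᵈ) of inf over g ∈ C²_γ(Q̄) of F(g,μ). Moreover 𝒫(Q̄×𝒦×ℝᵈ) may be replaced by the set ℳ_{𝒜,Q} of infinitesimal ergodic occupation measures, so that ρ = sup over μ ∈ ℳ_{𝒜,Q} of ∫ R(x,ξ,y) μ(dx,dξ,dy). -/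

import Mathlib

open MeasureTheory Filter Topology Metric Set
open scoped Matrix ENNReal NNReal

noncomputable section

namespace RS

variable {d : ℕ} {K : Type*}

abbrev Vec (d : ℕ) := Fin d → ℝ

/-- Euclidean norm on `Vec d`. -/
def nrm (x : Vec d) : ℝ := Real.sqrt (∑ i, (x i) ^ 2)

/-- Hilbert–Schmidt norm of a matrix. -/
def hsNorm (M : Matrix (Fin d) (Fin d) ℝ) : ℝ := Real.sqrt (∑ i, ∑ j, (M i j) ^ 2)

/-- The gradient, as the vector of partial derivatives. -/
def grad (f : Vec d → ℝ) (x : Vec d) : Vec d := fun i => fderiv ℝ f x (Pi.single i 1)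

/-- The Hessian matrix. -/
def hess (f : Vec d → ℝ) (x : Vec d) : Matrix (Fin d) (Fin d) ℝ := fun i j =>
  fderiv ℝ (fun y => fderiv ℝ f y (Pi.single j 1)) x (Pi.single i 1)

/-- `trProd A H = trace (A ⬝ H)`. -/
def trProd (A H : Matrix (Fin d) (Fin d) ℝ) : ℝ := ∑ i, ∑ j, A i j * H j i

/-- The diffusion matrix `a = σ σᵀ`. -/
def amat (σm : Vec d → Matrix (Fin d) (Fin d) ℝ) (x : Vec d) : Matrix (Fin d) (Fin d) ℝ :=
  σm x * (σm x)ᵀ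

/-- `L_β f = ½ tr(a ∇²f) + ⟨β, ∇f⟩`, the generator with drift `β`. -/
def Lop (σm : Vec d → Matrix (Fin d) (Fin d) ℝ) (β : Vec d → Vec d) (f : Vec d → ℝ)
    (x : Vec d) : ℝ :=
  (1 / 2) * trProd (amat σm x) (hess f x) + (β x) ⬝ᵥ (grad f x)

/-- `L_ξ f = ½ tr(a ∇²f) + ⟨b(·,ξ), ∇f⟩`. -/
def Lxi (σm : Vec d → Matrix (Fin d) (Fin d) ℝ) (b : Vec d → K → Vec d) (ξ : K)
    (f : Vec d → ℝ) (x : Vec d) : ℝ :=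
  (1 / 2) * trProd (amat σm x) (hess f x) + (b x ξ) ⬝ᵥ (grad f x)

/-- The semilinear (maximal) operator `𝒢`. -/
def Gop (σm : Vec d → Matrix (Fin d) (Fin d) ℝ) (b : Vec d → K → Vec d)
    (c : Vec d → K → ℝ) (f : Vec d → ℝ) (x : Vec d) : ℝ :=
  (1 / 2) * trProd (amat σm x) (hess f x) +
    ⨆ ξ : K, ((b x ξ) ⬝ᵥ (grad f x) + c x ξ * f x)

/-- The minimal operator `𝒢̂` (risk-sensitive cost minimization). -/
def Gmin (σm : Vec d → Matrix (Fin d) (Fin d) ℝ) (b : Vec d → K → Vec d)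
    (c : Vec d → K → ℝ) (f : Vec d → ℝ) (x : Vec d) : ℝ :=
  (1 / 2) * trProd (amat σm x) (hess f x) +
    ⨅ ξ : K, ((b x ξ) ⬝ᵥ (grad f x) + c x ξ * f x)

/-- Extended-real-valued integral of a real function (equal to `∫f⁺ − ∫f⁻`). -/
def integralE {α : Type*} [MeasurableSpace α] (μ : Measure α) (f : α → ℝ) : EReal :=
  ((∫⁻ x, ENNReal.ofReal (f x) ∂μ : ℝ≥0∞) : EReal) -
    ((∫⁻ x, ENNReal.ofReal (-f x) ∂μ : ℝ≥0∞) : EReal)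

/-- The state space `𝒵 = ℝᵈ × 𝒦 × ℝᵈ`. -/
abbrev Zs (d : ℕ) (K : Type*) := Vec d × K × Vec d

/-- The operator `𝒜 g (x,ξ,y) = ½ tr(a ∇²g) + ⟨b(x,ξ) + a(x) y, ∇g(x)⟩`. -/
def Aop (σm : Vec d → Matrix (Fin d) (Fin d) ℝ) (b : Vec d → K → Vec d)
    (g : Vec d → ℝ) (z : Zs d K) : ℝ :=
  (1 / 2) * trProd (amat σm z.1) (hess g z.1) +
    (b z.1 z.2.1 + (amat σm z.1) *ᵥ z.2.2) ⬝ᵥ (grad g z.1)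

/-- The reward `R(x,ξ,y) = c(x,ξ) − ½|σᵀ(x)y|²`. -/
def Rfun (σm : Vec d → Matrix (Fin d) (Fin d) ℝ) (c : Vec d → K → ℝ) (z : Zs d K) : ℝ :=
  c z.1 z.2.1 - (1 / 2) * (((σm z.1)ᵀ *ᵥ z.2.2) ⬝ᵥ ((σm z.1)ᵀ *ᵥ z.2.2))

/-- `F(g,μ) = ∫ (𝒜g + R) dμ`, valued in the extended reals. -/
def Ffun [MeasurableSpace K] (σm : Vec d → Matrix (Fin d) (Fin d) ℝ)
    (b : Vec d → K → Vec d) (c : Vec d → K → ℝ) (g : Vec d → ℝ)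
    (μ : Measure (Zs d K)) : EReal :=
  integralE μ fun z => Aop σm b g z + Rfun σm c z

/-- The set of infinitesimal ergodic occupation measures `ℳ_𝒜` of `𝒜`. -/
def eomA (K : Type*) [MeasurableSpace K] (σm : Vec d → Matrix (Fin d) (Fin d) ℝ)
    (b : Vec d → K → Vec d) : Set (Measure (Zs d K)) :=
  {μ | IsProbabilityMeasure μ ∧ ∀ f : Vec d → ℝ, ContDiff ℝ 2 f → HasCompactSupport f →
    Integrable (fun z => Aop σm b f z) μ ∧ ∫ z, Aop σm b f z ∂μ = 0}

/-- The infinitesimal relative entropy rate `ℋ = ½|σᵀ ∇(log Φ)|²`. -/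
def Hfun (σm : Vec d → Matrix (Fin d) (Fin d) ℝ) (Φ : Vec d → ℝ) (x : Vec d) : ℝ :=
  (1 / 2) * (((σm x)ᵀ *ᵥ grad (fun y => Real.log (Φ y)) x) ⬝ᵥ
    ((σm x)ᵀ *ᵥ grad (fun y => Real.log (Φ y)) x))

/-- `𝒫_*(𝒵)`: probability measures with `∫ ℋ dμ < ∞`. -/
def Pstar (K : Type*) [MeasurableSpace K] (σm : Vec d → Matrix (Fin d) (Fin d) ℝ)
    (Φ : Vec d → ℝ) : Set (Measure (Zs d K)) :=
  {μ | IsProbabilityMeasure μ ∧ (∫⁻ z : Zs d K, ENNReal.ofReal (Hfun σm Φ z.1) ∂μ) < ⊤}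

/-- `𝒫_∘(𝒵)`: probability measures with `∫ R dμ > −∞`. -/
def Pcirc (K : Type*) [MeasurableSpace K] (σm : Vec d → Matrix (Fin d) (Fin d) ℝ)
    (c : Vec d → K → ℝ) : Set (Measure (Zs d K)) :=
  {μ | IsProbabilityMeasure μ ∧ (⊥ : EReal) < integralE μ (Rfun σm c)}

/-- `𝒫(𝒵)`: all (Borel) probability measures on `𝒵`. -/
def Pall (d : ℕ) (K : Type*) [MeasurableSpace K] : Set (Measure (Zs d K)) :=
  {μ | IsProbabilityMeasure μ}

/-- `C²_c(ℝᵈ)` test functions. -/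
def testFns (d : ℕ) : Set (Vec d → ℝ) := {g | ContDiff ℝ 2 g ∧ HasCompactSupport g}

/-- `C²_pol(ℝᵈ)`: `C²` functions whose derivatives up to order two have
polynomial growth. -/
def C2pol (d : ℕ) : Set (Vec d → ℝ) :=
  {g | ContDiff ℝ 2 g ∧ ∃ C > 0, ∃ m : ℕ, ∀ x : Vec d,
    |g x| + nrm (grad g x) + hsNorm (hess g x) ≤ C * (1 + nrm x) ^ m}

/-- The co-normal direction `γ = a n⃗`, with unit outward normal
`n⃗ = ∇Φd/|∇Φd|` for a defining function `Φd` of the domain. -/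
def conormal (σm : Vec d → Matrix (Fin d) (Fin d) ℝ) (Φd : Vec d → ℝ)
    (x : Vec d) : Vec d :=
  (nrm (grad Φd x))⁻¹ • ((amat σm x) *ᵥ (grad Φd x))

/-- `C²_γ(Q̄)`: functions of class `C²` on (a neighborhood of) `Q̄` satisfying
the co-normal Neumann boundary condition `⟨∇f, γ⟩ = 0` on `∂Q`. -/
def C2gammaQ (Q : Set (Vec d)) (γv : Vec d → Vec d) : Set (Vec d → ℝ) :=
  {f | (∃ U : Set (Vec d), IsOpen U ∧ closure Q ⊆ U ∧ ContDiffOn ℝ 2 f U) ∧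
    ∀ x ∈ frontier Q, (grad f x) ⬝ᵥ (γv x) = 0}

/-- `𝒫(Q̄ × 𝒦 × ℝᵈ)`: probability measures on `𝒵` supported in `Q̄ × 𝒦 × ℝᵈ`. -/
def PQ (K : Type*) [MeasurableSpace K] (Q : Set (Vec d)) : Set (Measure (Zs d K)) :=
  {μ | IsProbabilityMeasure μ ∧ μ {z : Zs d K | z.1 ∉ closure Q} = 0}

/-- `ℳ_{𝒜,Q}`: infinitesimal ergodic occupation measures of `𝒜` on
`Q̄ × 𝒦 × ℝᵈ`. -/
def MQ (K : Type*) [MeasurableSpace K] (σm : Vec d → Matrix (Fin d) (Fin d) ℝ)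
    (b : Vec d → K → Vec d) (Q : Set (Vec d)) (γv : Vec d → Vec d) :
    Set (Measure (Zs d K)) :=
  {μ | μ ∈ PQ K Q ∧ ∀ f ∈ C2gammaQ Q γv,
    Integrable (fun z => Aop σm b f z) μ ∧ ∫ z, Aop σm b f z ∂μ = 0}

theorem fderiv_apply_eq_grad_dotProduct (f : Vec d → ℝ) (x v : Vec d) :
    fderiv ℝ f x v = grad f x ⬝ᵥ v := by
  have h := (fderiv ℝ f x).toLinearMap.pi_apply_eq_sum_univ v
  simp only [ContinuousLinearMap.coe_coe] at h
  rw [h]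
  simp only [dotProduct, grad, smul_eq_mul]
  refine Finset.sum_congr rfl fun i _ => ?_
  rw [mul_comm]
  congr 2
  ext j
  simp [Pi.single_apply, eq_comm]

theorem contDiffAt_fderiv_apply {f : Vec d → ℝ} {x : Vec d} (hf : ContDiffAt ℝ 2 f x)
    (v : Vec d) : ContDiffAt ℝ 1 (fun y => fderiv ℝ f y v) x :=
  (hf.fderiv_right (m := 1) (by norm_num)).clm_apply contDiffAt_const

theorem eventually_differentiableAt {f : Vec d → ℝ} {x : Vec d} (hf : ContDiffAt ℝ 2 f x) :
    ∀ᶠ y in 𝓝 x, DifferentiableAt ℝ f y := by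
  filter_upwards [hf.eventually (by simp)] with y hy
  exact hy.differentiableAt (by norm_num)

theorem fderiv_fderiv_apply {f : Vec d → ℝ} {x : Vec d} (hf : ContDiffAt ℝ 2 f x)
    (v w : Vec d) :
    fderiv ℝ (fun y => fderiv ℝ f y v) x w = w ⬝ᵥ (hess f x *ᵥ v) := by
  have h1 : (fun y => fderiv ℝ f y v) =
      fun y => ∑ j, fderiv ℝ f y (Pi.single j 1) * v j := by
    ext y
    rw [fderiv_apply_eq_grad_dotProduct]
    rfl
  have hd : ∀ j ∈ (Finset.univ : Finset (Fin d)), DifferentiableAt ℝ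
      (fun y => fderiv ℝ f y (Pi.single j 1) * v j) x := fun j _ =>
    ((contDiffAt_fderiv_apply hf _).differentiableAt (by norm_num)).mul_const _
  rw [h1, fderiv_fun_sum hd, _root_.sum_apply]
  simp only [dotProduct, Matrix.mulVec, Finset.mul_sum]
  rw [Finset.sum_comm]
  refine Finset.sum_congr rfl fun j _ => ?_
  rw [fderiv_mul_const ((contDiffAt_fderiv_apply hf _).differentiableAt (by norm_num)),
    _root_.smul_apply, fderiv_apply_eq_grad_dotProduct]
  simp only [dotProduct, smul_eq_mul, Finset.mul_sum, grad, hess]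
  exact Finset.sum_congr rfl fun i _ => by ring

theorem continuousAt_grad {f : Vec d → ℝ} {x : Vec d} (hf : ContDiffAt ℝ 2 f x) :
    ContinuousAt (grad f) x :=
  continuousAt_pi.2 fun _ => (contDiffAt_fderiv_apply hf _).continuousAt

theorem continuousAt_hess {f : Vec d → ℝ} {x : Vec d} (hf : ContDiffAt ℝ 2 f x) :
    ContinuousAt (hess f) x :=
  continuousAt_pi.2 fun _ => continuousAt_pi.2 fun _ =>
    (((contDiffAt_fderiv_apply hf _).fderiv_right (m := 0) (by norm_num)).clm_apply
      contDiffAt_const).continuousAt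

theorem grad_add {f g : Vec d → ℝ} {x : Vec d} (hf : DifferentiableAt ℝ f x)
    (hg : DifferentiableAt ℝ g x) : grad (f + g) x = grad f x + grad g x := by
  ext i
  simp [grad, fderiv_add hf hg]

theorem grad_const_smul (r : ℝ) (f : Vec d → ℝ) (x : Vec d) :
    grad (r • f) x = r • grad f x := by
  ext i
  simp [grad, fderiv_const_smul_field]

theorem hess_add {f g : Vec d → ℝ} {x : Vec d} (hf : ContDiffAt ℝ 2 f x)
    (hg : ContDiffAt ℝ 2 g x) : hess (f + g) x = hess f x + hess g x := by
  ext i j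
  have h : (fun y => fderiv ℝ (f + g) y (Pi.single j 1)) =ᶠ[𝓝 x]
      (fun y => fderiv ℝ f y (Pi.single j 1)) + fun y => fderiv ℝ g y (Pi.single j 1) := by
    filter_upwards [eventually_differentiableAt hf, eventually_differentiableAt hg]
      with y h1 h2
    simp [fderiv_add h1 h2]
  simp only [hess, Matrix.add_apply]
  rw [h.fderiv_eq, fderiv_add ((contDiffAt_fderiv_apply hf _).differentiableAt (by norm_num))
    ((contDiffAt_fderiv_apply hg _).differentiableAt (by norm_num))]
  rfl

theorem hess_const_smul (r : ℝ) (f : Vec d → ℝ) (x : Vec d) :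
    hess (r • f) x = r • hess f x := by
  ext i j
  have h : (fun y => fderiv ℝ (r • f) y (Pi.single j 1)) =
      r • fun y => fderiv ℝ f y (Pi.single j 1) := by
    ext y
    simp [fderiv_const_smul_field]
  simp only [hess, Matrix.smul_apply]
  rw [h, fderiv_const_smul_field]
  rfl

theorem grad_log {V : Vec d → ℝ} {x : Vec d} (hV : DifferentiableAt ℝ V x) (h0 : V x ≠ 0) :
    grad (fun y => Real.log (V y)) x = (V x)⁻¹ • grad V x := by
  ext i
  simp [grad, fderiv.log hV h0]

theorem hess_log {V : Vec d → ℝ} {x : Vec d} (hV : ContDiffAt ℝ 2 V x) (h0 : V x ≠ 0)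
    (i j : Fin d) :
    hess (fun y => Real.log (V y)) x i j =
      (V x)⁻¹ * hess V x i j - ((V x)⁻¹ * grad V x i) * ((V x)⁻¹ * grad V x j) := by
  have hVd : DifferentiableAt ℝ V x := hV.differentiableAt (by norm_num)
  have h : (fun y => fderiv ℝ (fun y => Real.log (V y)) y (Pi.single j 1)) =ᶠ[𝓝 x]
      fun y => (V y)⁻¹ * fderiv ℝ V y (Pi.single j 1) := by
    filter_upwards [eventually_differentiableAt hV,
      hV.continuousAt.eventually_ne h0] with y h1 h2
    simp [fderiv.log h1 h2]
  have hinv : HasFDerivAt (fun y => (V y)⁻¹) (-(V x ^ 2)⁻¹ • fderiv ℝ V x) x :=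
    (hasDerivAt_inv h0).comp_hasFDerivAt x hVd.hasFDerivAt
  have hmul := hinv.mul
    ((contDiffAt_fderiv_apply hV (Pi.single j 1)).differentiableAt (by norm_num)).hasFDerivAt
  unfold hess
  rw [h.fderiv_eq]
  erw [hmul.fderiv]
  simp only [_root_.add_apply, _root_.smul_apply, smul_eq_mul, grad]
  field_simp
  ring

theorem deriv_nonneg_of_right_min {φ : ℝ → ℝ} {m : ℝ} (hφ : HasDerivAt φ m 0)
    (hmin : ∀ᶠ s in 𝓝[>] (0 : ℝ), φ 0 ≤ φ s) : 0 ≤ m := by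
  have h := (hasDerivAt_iff_tendsto_slope.1 hφ).mono_left
    (nhdsWithin_mono (0 : ℝ) fun s (hs : s ∈ Ioi (0 : ℝ)) => ne_of_gt hs)
  refine ge_of_tendsto h ?_
  filter_upwards [hmin, self_mem_nhdsWithin] with s hs hs0
  rw [slope_def_field]
  exact div_nonneg (sub_nonneg.2 hs) (by simpa using (hs0 : (0 : ℝ) < s).le)

theorem second_deriv_nonneg_of_right_min {φ φ' : ℝ → ℝ} {m : ℝ}
    (hφ : ∀ᶠ s in 𝓝 (0 : ℝ), HasDerivAt φ (φ' s) s) (h0 : φ' 0 = 0)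
    (hφ' : HasDerivAt φ' m 0) (hmin : ∀ᶠ s in 𝓝[>] (0 : ℝ), φ 0 ≤ φ s) : 0 ≤ m := by
  by_contra! hm
  have h := (hasDerivAt_iff_tendsto_slope.1 hφ').mono_left
    (nhdsWithin_mono (0 : ℝ) fun s (hs : s ∈ Ioi (0 : ℝ)) => ne_of_gt hs)
  have hneg : ∀ᶠ s in 𝓝[>] (0 : ℝ), φ' s < 0 := by
    filter_upwards [h.eventually_lt_const hm, self_mem_nhdsWithin] with s hs hs0
    have hs0 : (0 : ℝ) < s := hs0
    rw [slope_def_field, h0, sub_zero, sub_zero, div_neg_iff] at hs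
    rcases hs with hs | hs
    · linarith [hs.2]
    · exact hs.1
  have hall := (hneg.and hmin).and (hφ.filter_mono nhdsWithin_le_nhds)
  obtain ⟨u, hu, hsub⟩ := mem_nhdsGT_iff_exists_Ioo_subset.1 hall
  have hu : (0 : ℝ) < u := hu
  have hd : ∀ s ∈ Ico 0 u, HasDerivAt φ (φ' s) s := by
    intro s hs
    rcases hs.1.eq_or_lt with rfl | hs0
    · exact hφ.self_of_nhds
    · exact (hsub ⟨hs0, hs.2⟩).2
  obtain ⟨t, ht, hts⟩ := exists_hasDerivAt_eq_slope φ φ' (half_pos hu)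
    (fun s hs => (hd s ⟨hs.1, by linarith [hs.2]⟩).continuousAt.continuousWithinAt)
    (fun s hs => hd s ⟨hs.1.le, by linarith [hs.2]⟩)
  have h1 := (hsub ⟨ht.1, by linarith [ht.2]⟩).1.1
  have h2 := (hsub (a := u / 2) ⟨half_pos hu, by linarith⟩).1.2
  rw [hts, sub_zero] at h1
  exact absurd h1 (not_lt.2 (div_nonneg (sub_nonneg.2 h2) (half_pos hu).le))

theorem hasDerivAt_line {f : Vec d → ℝ} {x v : Vec d} {s : ℝ}
    (hf : DifferentiableAt ℝ f (x + s • v)) :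
    HasDerivAt (fun t : ℝ => f (x + t • v)) (fderiv ℝ f (x + s • v) v) s := by
  have hl : HasDerivAt (fun t : ℝ => x + t • v) v s := by
    simpa using ((hasDerivAt_id s).smul_const v).const_add x
  exact hf.hasFDerivAt.comp_hasDerivAt s hl

theorem tendsto_line (x v : Vec d) : Tendsto (fun t : ℝ => x + t • v) (𝓝 0) (𝓝 x) := by
  have : Continuous fun t : ℝ => x + t • v := by fun_prop
  simpa using this.tendsto 0

/-- First-order condition at a minimum, along a feasible direction. -/
theorem grad_dotProduct_nonneg {f : Vec d → ℝ} {x v : Vec d} (hf : DifferentiableAt ℝ f x)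
    (hmin : ∀ᶠ s in 𝓝[>] (0 : ℝ), f x ≤ f (x + s • v)) : 0 ≤ grad f x ⬝ᵥ v := by
  have h := hasDerivAt_line (x := x) (v := v) (s := 0) (by simpa using hf)
  simp only [zero_smul, add_zero, fderiv_apply_eq_grad_dotProduct] at h
  exact deriv_nonneg_of_right_min h (by simpa using hmin)

/-- Second-order condition at a critical minimum, along a feasible direction. -/
theorem hess_quadratic_nonneg {f : Vec d → ℝ} {x v : Vec d} (hf : ContDiffAt ℝ 2 f x)
    (hgrad : grad f x = 0) (hmin : ∀ᶠ s in 𝓝[>] (0 : ℝ), f x ≤ f (x + s • v)) :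
    0 ≤ v ⬝ᵥ (hess f x *ᵥ v) := by
  refine second_deriv_nonneg_of_right_min (φ := fun s : ℝ => f (x + s • v))
    (φ' := fun s : ℝ => fderiv ℝ f (x + s • v) v) ?_ ?_ ?_ (by simpa using hmin)
  · filter_upwards [(tendsto_line x v).eventually (eventually_differentiableAt hf)] with s hs
    exact hasDerivAt_line hs
  · simp [fderiv_apply_eq_grad_dotProduct, hgrad]
  · have h := hasDerivAt_line (f := fun y => fderiv ℝ f y v) (x := x) (v := v) (s := 0)
      (by simpa using (contDiffAt_fderiv_apply hf v).differentiableAt (by norm_num))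
    simpa only [zero_smul, add_zero, fderiv_fderiv_apply hf] using h

theorem dotProduct_self_nonneg (v : Vec d) : 0 ≤ v ⬝ᵥ v :=
  Finset.sum_nonneg fun _ _ => mul_self_nonneg _

theorem dotProduct_amat_mulVec (σm : Vec d → Matrix (Fin d) (Fin d) ℝ) (x u v : Vec d) :
    (amat σm x *ᵥ u) ⬝ᵥ v = ((σm x)ᵀ *ᵥ u) ⬝ᵥ ((σm x)ᵀ *ᵥ v) := by
  rw [amat, ← Matrix.mulVec_mulVec, dotProduct_comm, Matrix.dotProduct_mulVec,
    ← Matrix.mulVec_transpose, dotProduct_comm]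

theorem trProd_amat_nonneg (σm : Vec d → Matrix (Fin d) (Fin d) ℝ) (x : Vec d)
    {H : Matrix (Fin d) (Fin d) ℝ} (hH : ∀ v : Vec d, 0 ≤ v ⬝ᵥ (H *ᵥ v)) :
    0 ≤ trProd (amat σm x) H := by
  have h : trProd (amat σm x) H =
      ∑ k, (fun i => σm x i k) ⬝ᵥ (H *ᵥ fun i => σm x i k) := by
    simp only [trProd, amat, Matrix.mul_apply, Matrix.transpose_apply, dotProduct,
      Matrix.mulVec, Finset.mul_sum, Finset.sum_mul]
    rw [Finset.sum_comm]
    refine (Finset.sum_congr rfl fun j _ => Finset.sum_comm).trans ?_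
    rw [Finset.sum_comm]
    exact Finset.sum_congr rfl fun k _ => Finset.sum_congr rfl fun i _ =>
      Finset.sum_congr rfl fun j _ => by ring
  rw [h]
  exact Finset.sum_nonneg fun k _ => hH _

theorem contDiffAt_of_mem_C2gammaQ {Q : Set (Vec d)} {γv : Vec d → Vec d} {f : Vec d → ℝ}
    (hf : f ∈ C2gammaQ Q γv) {x : Vec d} (hx : x ∈ closure Q) : ContDiffAt ℝ 2 f x := by
  obtain ⟨⟨U, hU, hQU, hfU⟩, -⟩ := hf
  exact hfU.contDiffAt (hU.mem_nhds (hQU hx))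

theorem add_mem_C2gammaQ {Q : Set (Vec d)} {γv : Vec d → Vec d} {f g : Vec d → ℝ}
    (hf : f ∈ C2gammaQ Q γv) (hg : g ∈ C2gammaQ Q γv) : f + g ∈ C2gammaQ Q γv := by
  refine ⟨?_, fun x hx => ?_⟩
  · obtain ⟨⟨U, hU, hQU, hfU⟩, -⟩ := hf
    obtain ⟨⟨W, hW, hQW, hgW⟩, -⟩ := hg
    exact ⟨U ∩ W, hU.inter hW, subset_inter hQU hQW,
      (hfU.mono inter_subset_left).add (hgW.mono inter_subset_right)⟩
  · have hx' := frontier_subset_closure hx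
    rw [grad_add ((contDiffAt_of_mem_C2gammaQ hf hx').differentiableAt (by norm_num))
      ((contDiffAt_of_mem_C2gammaQ hg hx').differentiableAt (by norm_num)),
      add_dotProduct, hf.2 x hx, hg.2 x hx, add_zero]

theorem const_smul_mem_C2gammaQ {Q : Set (Vec d)} {γv : Vec d → Vec d} (r : ℝ)
    {f : Vec d → ℝ} (hf : f ∈ C2gammaQ Q γv) : r • f ∈ C2gammaQ Q γv := by
  refine ⟨?_, fun x hx => ?_⟩
  · obtain ⟨⟨U, hU, hQU, hfU⟩, -⟩ := hf
    exact ⟨U, hU, hQU, hfU.const_smul r⟩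
  · rw [grad_const_smul, smul_dotProduct, hf.2 x hx, smul_zero]

theorem log_mem_C2gammaQ {Q : Set (Vec d)} {γv : Vec d → Vec d} {V : Vec d → ℝ}
    (hV : V ∈ C2gammaQ Q γv) (hpos : ∀ x ∈ closure Q, 0 < V x) :
    (fun x => Real.log (V x)) ∈ C2gammaQ Q γv := by
  refine ⟨?_, fun x hx => ?_⟩
  · obtain ⟨⟨U, hU, hQU, hVU⟩, -⟩ := hV
    refine ⟨U ∩ V ⁻¹' Ioi 0, hVU.continuousOn.isOpen_inter_preimage hU isOpen_Ioi,
      fun x hx => ⟨hQU hx, hpos x hx⟩, ?_⟩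
    exact (hVU.mono inter_subset_left).log fun x hx => ne_of_gt hx.2
  · have hx' := frontier_subset_closure hx
    rw [grad_log ((contDiffAt_of_mem_C2gammaQ hV hx').differentiableAt (by norm_num))
      (hpos x hx').ne', smul_dotProduct, hV.2 x hx, smul_zero]

theorem trProd_add (A H H' : Matrix (Fin d) (Fin d) ℝ) :
    trProd A (H + H') = trProd A H + trProd A H' := by
  simp [trProd, mul_add, Finset.sum_add_distrib]

theorem trProd_smul (A H : Matrix (Fin d) (Fin d) ℝ) (r : ℝ) :
    trProd A (r • H) = r * trProd A H := by
  simp [trProd, Finset.mul_sum, mul_left_comm]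

theorem Aop_add (σm : Vec d → Matrix (Fin d) (Fin d) ℝ) (b : Vec d → K → Vec d)
    {f g : Vec d → ℝ} {z : Zs d K} (hf : ContDiffAt ℝ 2 f z.1) (hg : ContDiffAt ℝ 2 g z.1) :
    Aop σm b (f + g) z = Aop σm b f z + Aop σm b g z := by
  rw [Aop, hess_add hf hg, grad_add (hf.differentiableAt (by norm_num))
    (hg.differentiableAt (by norm_num)), trProd_add, dotProduct_add, Aop, Aop]
  ring

theorem Aop_const_smul (σm : Vec d → Matrix (Fin d) (Fin d) ℝ) (b : Vec d → K → Vec d)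
    (r : ℝ) (f : Vec d → ℝ) (z : Zs d K) :
    Aop σm b (r • f) z = r * Aop σm b f z := by
  rw [Aop, hess_const_smul, grad_const_smul, trProd_smul, dotProduct_smul, Aop, smul_eq_mul]
  ring

theorem continuous_trProd :
    Continuous fun p : Matrix (Fin d) (Fin d) ℝ × Matrix (Fin d) (Fin d) ℝ =>
      trProd p.1 p.2 := by
  unfold trProd
  refine continuous_finsetSum _ fun i _ => continuous_finsetSum _ fun j _ => ?_
  exact (continuous_fst.matrix_elem i j).mul (continuous_snd.matrix_elem j i)

theorem continuous_amat {σm : Vec d → Matrix (Fin d) (Fin d) ℝ} (hσ : Continuous σm) :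
    Continuous (amat σm) :=
  hσ.matrix_mul hσ.matrix_transpose

theorem continuousAt_Aop [TopologicalSpace K] {σm : Vec d → Matrix (Fin d) (Fin d) ℝ}
    {b : Vec d → K → Vec d} (hσ : Continuous σm)
    (hb : Continuous fun p : Vec d × K => b p.1 p.2) {f : Vec d → ℝ} {z : Zs d K}
    (hf : ContDiffAt ℝ 2 f z.1) : ContinuousAt (Aop σm b f) z := by
  have ha : Continuous fun z : Zs d K => amat σm z.1 := (continuous_amat hσ).comp continuous_fst
  have hH : ContinuousAt (fun z : Zs d K => hess f z.1) z :=
    (continuousAt_hess hf).comp continuousAt_fst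
  have hG : ContinuousAt (fun z : Zs d K => grad f z.1) z :=
    (continuousAt_grad hf).comp continuousAt_fst
  have hβ : Continuous fun z : Zs d K => b z.1 z.2.1 + amat σm z.1 *ᵥ z.2.2 :=
    (hb.comp (continuous_fst.prodMk (continuous_fst.comp continuous_snd))).add
      (ha.matrix_mulVec (continuous_snd.comp continuous_snd))
  have htr : ContinuousAt (fun z : Zs d K => trProd (amat σm z.1) (hess f z.1)) z :=
    ContinuousAt.comp
      (g := fun p : Matrix (Fin d) (Fin d) ℝ × Matrix (Fin d) (Fin d) ℝ => trProd p.1 p.2)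
      (f := fun z : Zs d K => (amat σm z.1, hess f z.1))
      continuous_trProd.continuousAt (ha.continuousAt.prodMk hH)
  have hdot : Continuous fun p : Vec d × Vec d => p.1 ⬝ᵥ p.2 :=
    continuous_fst.dotProduct continuous_snd
  exact (continuousAt_const.mul htr).add
    (hdot.continuousAt.comp (hβ.continuousAt.prodMk hG))

/-- A vector `p`, annihilated by an oblique direction `w` and nonnegative on the half-space
`⟨n, ·⟩ < 0`, vanishes. -/
theorem eq_zero_of_dotProduct_nonneg {p n w : Vec d} (hnw : 0 < n ⬝ᵥ w) (hpw : p ⬝ᵥ w = 0)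
    (hp : ∀ v : Vec d, n ⬝ᵥ v < 0 → 0 ≤ p ⬝ᵥ v) : p = 0 := by
  have hev : ∀ᶠ ε in 𝓝[>] (0 : ℝ), n ⬝ᵥ (-w - ε • p) < 0 := by
    have hc : Continuous fun ε : ℝ => n ⬝ᵥ (-w - ε • p) := by fun_prop
    exact (hc.continuousAt.eventually_lt_const (by simpa using hnw)).filter_mono
      nhdsWithin_le_nhds
  obtain ⟨ε, hε, hε0⟩ := (hev.and self_mem_nhdsWithin).exists
  have h := hp _ hε
  have hε0 : 0 < ε := hε0
  rw [dotProduct_sub, dotProduct_neg, hpw, dotProduct_smul, smul_eq_mul] at h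
  have hpp : 0 ≤ p ⬝ᵥ p := dotProduct_self_nonneg p
  exact dotProduct_self_eq_zero.1 (by nlinarith)

/-- A quadratic form that is nonnegative on an open half-space is nonnegative. -/
theorem quadratic_nonneg_of_halfspace {H : Matrix (Fin d) (Fin d) ℝ} {n : Vec d} (hn : n ≠ 0)
    (hH : ∀ v : Vec d, n ⬝ᵥ v < 0 → 0 ≤ v ⬝ᵥ (H *ᵥ v)) (v : Vec d) :
    0 ≤ v ⬝ᵥ (H *ᵥ v) := by
  have hne : ∀ v : Vec d, n ⬝ᵥ v ≠ 0 → 0 ≤ v ⬝ᵥ (H *ᵥ v) := by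
    intro v hv
    rcases hv.lt_or_gt with h | h
    · exact hH v h
    · simpa [Matrix.mulVec_neg] using hH (-v) (by simpa using h)
  by_cases hv : n ⬝ᵥ v = 0
  · have hc : Continuous fun t : ℝ => (v + t • n) ⬝ᵥ (H *ᵥ (v + t • n)) := by fun_prop
    have ht : Tendsto (fun t : ℝ => (v + t • n) ⬝ᵥ (H *ᵥ (v + t • n))) (𝓝[≠] 0)
        (𝓝 (v ⬝ᵥ (H *ᵥ v))) := by
      simpa using (hc.tendsto 0).mono_left (nhdsWithin_le_nhds (s := {0}ᶜ))
    refine ge_of_tendsto ht ?_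
    filter_upwards [self_mem_nhdsWithin] with t ht0
    apply hne
    rw [dotProduct_add, hv, dotProduct_smul, zero_add, smul_eq_mul]
    exact mul_ne_zero ht0 fun h => hn (dotProduct_self_eq_zero.1 h)
  · exact hne v hv

/-- Under the co-normal boundary condition, a minimum over `Q̄` is a critical point with
nonnegative Hessian, even when it is attained on the boundary. -/
theorem exists_critical_point_hess_nonneg {Q : Set (Vec d)} (hQo : IsOpen Q)
    (hQb : Bornology.IsBounded Q) (hQne : Q.Nonempty) {Φd : Vec d → ℝ}
    (hΦd : ContDiff ℝ 2 Φd) (hQdef : Q = {x | Φd x < 0}) (hQbd : frontier Q = {x | Φd x = 0})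
    (hΦgrad : ∀ x ∈ frontier Q, grad Φd x ≠ 0) {σm : Vec d → Matrix (Fin d) (Fin d) ℝ}
    (hell : ∃ θ > 0, ∀ x ∈ closure Q, ∀ v : Vec d,
      θ * (v ⬝ᵥ v) ≤ v ⬝ᵥ ((amat σm x) *ᵥ v))
    {f : Vec d → ℝ} (hf : f ∈ C2gammaQ Q (conormal σm Φd)) :
    ∃ x ∈ closure Q, grad f x = 0 ∧ ∀ v : Vec d, 0 ≤ v ⬝ᵥ (hess f x *ᵥ v) := by
  obtain ⟨x, hx, hmin⟩ := hQb.isCompact_closure.exists_isMinOn hQne.closure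
    fun x hx => (contDiffAt_of_mem_C2gammaQ hf hx).continuousAt.continuousWithinAt
  have hfx := contDiffAt_of_mem_C2gammaQ hf hx
  have hfd : DifferentiableAt ℝ f x := hfx.differentiableAt (by norm_num)
  refine ⟨x, hx, ?_⟩
  by_cases hxQ : x ∈ Q
  · have hfeas : ∀ v : Vec d, ∀ᶠ s in 𝓝[>] (0 : ℝ), f x ≤ f (x + s • v) := by
      intro v
      filter_upwards [((tendsto_line x v).eventually (hQo.mem_nhds hxQ)).filter_mono
        nhdsWithin_le_nhds] with s hs
      exact hmin (subset_closure hs)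
    have hg : grad f x = 0 := by
      have h := grad_dotProduct_nonneg hfd (hfeas (-grad f x))
      rw [dotProduct_neg] at h
      have hpp : 0 ≤ grad f x ⬝ᵥ grad f x := dotProduct_self_nonneg _
      exact dotProduct_self_eq_zero.1 (by linarith)
    exact ⟨hg, fun v => hess_quadratic_nonneg hfx hg (hfeas v)⟩
  · have hxf : x ∈ frontier Q := by rw [hQo.frontier_eq]; exact ⟨hx, hxQ⟩
    have hn := hΦgrad x hxf
    have hΦ0 : Φd x = 0 := by rw [hQbd] at hxf; exact hxf
    have hfeas : ∀ v : Vec d, grad Φd x ⬝ᵥ v < 0 →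
        ∀ᶠ s in 𝓝[>] (0 : ℝ), f x ≤ f (x + s • v) := by
      intro v hv
      have hd := hasDerivAt_line (f := Φd) (x := x) (v := v) (s := 0)
        (hΦd.differentiable (by norm_num) _)
      simp only [zero_smul, add_zero, fderiv_apply_eq_grad_dotProduct] at hd
      have hs := ((hasDerivAt_iff_tendsto_slope.1 hd).mono_left (nhdsWithin_mono (0 : ℝ)
        fun s (hs : s ∈ Ioi (0 : ℝ)) => ne_of_gt hs)).eventually_lt_const hv
      filter_upwards [hs, self_mem_nhdsWithin] with s hs hs0
      have hs0 : 0 < s := hs0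
      simp only [slope_def_field, zero_smul, add_zero, hΦ0, sub_zero] at hs
      have hneg : Φd (x + s • v) < 0 := by
        by_contra! h
        exact absurd hs (not_lt.2 (div_nonneg h hs0.le))
      exact hmin (subset_closure (by rw [hQdef]; exact hneg))
    obtain ⟨θ, hθ, hell⟩ := hell
    have hnn : 0 < grad Φd x ⬝ᵥ grad Φd x :=
      lt_of_le_of_ne (dotProduct_self_nonneg _) fun h => hn (dotProduct_self_eq_zero.1 h.symm)
    have hw : 0 < grad Φd x ⬝ᵥ (amat σm x *ᵥ grad Φd x) :=
      (mul_pos hθ hnn).trans_le (hell x hx _)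
    have hpw : grad f x ⬝ᵥ (amat σm x *ᵥ grad Φd x) = 0 := by
      have h := hf.2 x hxf
      rw [conormal, dotProduct_smul, smul_eq_mul] at h
      refine (mul_eq_zero.1 h).resolve_left (inv_ne_zero (ne_of_gt ?_))
      exact Real.sqrt_pos.2 (by simpa [dotProduct, sq] using hnn)
    have hg := eq_zero_of_dotProduct_nonneg hw hpw
      fun v hv => grad_dotProduct_nonneg hfd (hfeas v hv)
    exact ⟨hg, quadratic_nonneg_of_halfspace hn
      fun v hv => hess_quadratic_nonneg hfx hg (hfeas v hv)⟩

/-- A subspace of `C(X, ℝ)` containing no strictly negative function is annihilated by a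
probability measure. -/
theorem exists_isProbabilityMeasure_integral_eq_zero {X : Type*} [TopologicalSpace X]
    [CompactSpace X] [T2Space X] [MeasurableSpace X] [BorelSpace X] [Nonempty X]
    (E : Submodule ℝ C(X, ℝ)) (hE : ∀ f ∈ E, ∃ x, 0 ≤ f x) :
    ∃ μ : Measure X, IsProbabilityMeasure μ ∧ ∀ f ∈ E, ∫ x, f x ∂μ = 0 := by
  have hbdd : ∀ f : C(X, ℝ), BddAbove (range f) := fun f =>
    (isCompact_range f.continuous).bddAbove
  obtain ⟨Λ, hΛE, hΛ⟩ := exists_extension_of_le_sublinear ⟨E, 0⟩ (fun f : C(X, ℝ) => ⨆ x, f x)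
    (fun r hr f => by simp [Real.mul_iSup_of_nonneg hr.le])
    (fun f g => ciSup_le fun x => add_le_add (le_ciSup (hbdd f) x) (le_ciSup (hbdd g) x))
    (fun f => by
      obtain ⟨x, hx⟩ := hE f f.2
      exact hx.trans (le_ciSup (hbdd f) x))
  have hpos : ∀ f : C(X, ℝ), (∀ x, 0 ≤ f x) → 0 ≤ Λ f := by
    intro f hf
    have h : Λ (-f) ≤ 0 := (hΛ (-f)).trans (ciSup_le fun x => by simpa using hf x)
    rw [map_neg] at h
    linarith
  have hone : Λ 1 = 1 := by
    have h1 := hΛ 1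
    have h2 := hΛ (-1)
    simp only [map_neg, ContinuousMap.neg_apply, ContinuousMap.one_apply, ciSup_const] at h1 h2
    linarith
  let Λc : CompactlySupportedContinuousMap X ℝ →ₚ[ℝ] ℝ := PositiveLinearMap.mk₀
    { toFun := fun f => Λ f.toContinuousMap
      map_add' := fun f g => Λ.map_add f.toContinuousMap g.toContinuousMap
      map_smul' := fun r f => Λ.map_smul r f.toContinuousMap }
    fun f hf => hpos _ fun x => hf x
  have hint : ∀ f : C(X, ℝ), ∫ x, f x ∂(RealRMK.rieszMeasure Λc) = Λ f := fun f =>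
    RealRMK.integral_rieszMeasure Λc (CompactlySupportedContinuousMap.continuousMapEquiv f)
  refine ⟨RealRMK.rieszMeasure Λc, ⟨?_⟩, fun f hf => (hint f).trans (hΛE ⟨f, hf⟩)⟩
  have h := hint 1
  rw [hone] at h
  simp only [ContinuousMap.one_apply, integral_const, smul_eq_mul, mul_one] at h
  rw [← ENNReal.toReal_eq_one_iff]
  exact h

theorem integralE_eq_integral {α : Type*} [MeasurableSpace α] {μ : Measure α} {f : α → ℝ}
    (hf : Integrable f μ) : integralE μ f = ((∫ x, f x ∂μ : ℝ) : EReal) := by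
  rw [integral_eq_lintegral_pos_part_sub_lintegral_neg_part hf, EReal.coe_sub,
    EReal.coe_ennreal_toReal hf.lintegral_lt_top.ne,
    EReal.coe_ennreal_toReal (x := ∫⁻ x, ENNReal.ofReal (-f x) ∂μ) hf.neg.lintegral_lt_top.ne]
  rfl

theorem integralE_mono_ae {α : Type*} [MeasurableSpace α] {μ : Measure α} {f h : α → ℝ}
    (hfh : ∀ᵐ x ∂μ, f x ≤ h x) : integralE μ f ≤ integralE μ h :=
  EReal.sub_le_sub
    (EReal.coe_ennreal_le_coe_ennreal_iff.2
      (lintegral_mono_ae (hfh.mono fun _ hx => ENNReal.ofReal_le_ofReal hx)))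
    (EReal.coe_ennreal_le_coe_ennreal_iff.2
      (lintegral_mono_ae (hfh.mono fun _ hx => ENNReal.ofReal_le_ofReal (neg_le_neg hx))))

theorem Aop_log_add_Rfun (σm : Vec d → Matrix (Fin d) (Fin d) ℝ) (b : Vec d → K → Vec d)
    (c : Vec d → K → ℝ) {V : Vec d → ℝ} {z : Zs d K} (hV : ContDiffAt ℝ 2 V z.1)
    (h0 : V z.1 ≠ 0) :
    Aop σm b (fun x => Real.log (V x)) z + Rfun σm c z =
      (V z.1)⁻¹ * Aop σm b V (z.1, z.2.1, 0) + c z.1 z.2.1 -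
        (1 / 2) * (((σm z.1)ᵀ *ᵥ (z.2.2 - (V z.1)⁻¹ • grad V z.1)) ⬝ᵥ
          ((σm z.1)ᵀ *ᵥ (z.2.2 - (V z.1)⁻¹ • grad V z.1))) := by
  obtain ⟨x, ξ, y⟩ := z
  simp only at hV h0 ⊢
  set q := (V x)⁻¹ • grad V x with hq
  have htr : trProd (amat σm x) (hess (fun x => Real.log (V x)) x) =
      (V x)⁻¹ * trProd (amat σm x) (hess V x) - (amat σm x *ᵥ q) ⬝ᵥ q := by
    simp only [trProd, hess_log hV h0, Finset.mul_sum, dotProduct, Matrix.mulVec,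
      Finset.sum_mul, ← Finset.sum_sub_distrib]
    refine Finset.sum_congr rfl fun i _ => Finset.sum_congr rfl fun j _ => ?_
    simp only [hq, Pi.smul_apply, smul_eq_mul]
    ring
  have hb : b x ξ ⬝ᵥ q = (V x)⁻¹ * (b x ξ ⬝ᵥ grad V x) := by
    rw [hq, dotProduct_smul, smul_eq_mul]
  simp only [Aop, Rfun, htr, grad_log (hV.differentiableAt (by norm_num)) h0, ← hq,
    add_dotProduct, dotProduct_amat_mulVec, Matrix.mulVec_zero, zero_dotProduct, hb,
    Matrix.mulVec_sub, sub_dotProduct, dotProduct_sub]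
  rw [dotProduct_comm ((σm x)ᵀ *ᵥ q) ((σm x)ᵀ *ᵥ y)]
  ring

theorem continuousOn_sub_eigenvalue [TopologicalSpace K]
    {σm : Vec d → Matrix (Fin d) (Fin d) ℝ} {b : Vec d → K → Vec d} {c : Vec d → K → ℝ}
    (hσ : Continuous σm) (hb : Continuous fun p : Vec d × K => b p.1 p.2)
    (hc : Continuous fun p : Vec d × K => c p.1 p.2) (ρ : ℝ) {Q : Set (Vec d)}
    {γv : Vec d → Vec d} {V : Vec d → ℝ} (hV : V ∈ C2gammaQ Q γv) :
    ContinuousOn (fun p : Vec d × K =>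
      Aop σm b V (p.1, p.2, 0) + c p.1 p.2 * V p.1 - ρ * V p.1) (closure Q ×ˢ univ) := by
  intro p hp
  have hVp := contDiffAt_of_mem_C2gammaQ hV hp.1
  have hA : ContinuousAt (fun p : Vec d × K => Aop σm b V (p.1, p.2, 0)) p :=
    ContinuousAt.comp (g := Aop σm b V) (f := fun p : Vec d × K => (p.1, p.2, 0))
      (continuousAt_Aop hσ hb hVp) (by fun_prop)
  have hVc : ContinuousAt (fun p : Vec d × K => V p.1) p :=
    hVp.continuousAt.comp continuousAt_fst
  exact ((hA.add (hc.continuousAt.mul hVc)).sub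
    (continuousAt_const.mul hVc)).continuousWithinAt

/-- The eigenvalue equation on `Q` extends to `Q̄`, with an optimal control at each point. -/
theorem eigenvalue_equation_closure [TopologicalSpace K] [CompactSpace K] [Nonempty K]
    {σm : Vec d → Matrix (Fin d) (Fin d) ℝ} {b : Vec d → K → Vec d} {c : Vec d → K → ℝ}
    (hσ : Continuous σm) (hb : Continuous fun p : Vec d × K => b p.1 p.2)
    (hc : Continuous fun p : Vec d × K => c p.1 p.2) {ρ : ℝ} {Q : Set (Vec d)}
    (hQb : Bornology.IsBounded Q) {γv : Vec d → Vec d} {V : Vec d → ℝ}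
    (hV : V ∈ C2gammaQ Q γv) (hG : ∀ x ∈ Q, Gop σm b c V x = ρ * V x) :
    (∀ x ∈ closure Q, ∀ ξ, Aop σm b V (x, ξ, 0) + c x ξ * V x - ρ * V x ≤ 0) ∧
      IsCompact {p : Vec d × K | p.1 ∈ closure Q ∧
        Aop σm b V (p.1, p.2, 0) + c p.1 p.2 * V p.1 - ρ * V p.1 = 0} ∧
      ∀ x ∈ closure Q, ∃ ξ, Aop σm b V (x, ξ, 0) + c x ξ * V x - ρ * V x = 0 := by
  have hcont := continuousOn_sub_eigenvalue hσ hb hc ρ hV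
  have hA : ∀ x ξ, Aop σm b V (x, ξ, 0) + c x ξ * V x =
      (1 / 2) * trProd (amat σm x) (hess V x) + (b x ξ ⬝ᵥ grad V x + c x ξ * V x) := by
    intro x ξ
    simp [Aop, add_assoc]
  have hctrl : ∀ x, Continuous fun ξ => b x ξ ⬝ᵥ grad V x + c x ξ * V x := by
    intro x
    have h1 : Continuous fun ξ => b x ξ := hb.comp (Continuous.prodMk_right x)
    have h2 : Continuous fun ξ => c x ξ := hc.comp (Continuous.prodMk_right x)
    exact (h1.dotProduct continuous_const).add (h2.mul continuous_const)
  have hcompact : IsCompact {p : Vec d × K | p.1 ∈ closure Q ∧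
      Aop σm b V (p.1, p.2, 0) + c p.1 p.2 * V p.1 - ρ * V p.1 = 0} := by
    have hS : IsCompact (closure Q ×ˢ (univ : Set K)) := hQb.isCompact_closure.prod isCompact_univ
    have hcl := hcont.preimage_isClosed_of_isClosed (isClosed_closure.prod isClosed_univ)
      (isClosed_singleton (x := (0 : ℝ)))
    convert hS.of_isClosed_subset hcl inter_subset_left using 1
    ext p
    simp
  refine ⟨fun x hx ξ => ?_, hcompact, fun x hx => ?_⟩
  · refine le_on_closure (s := Q)
      (f := fun x => Aop σm b V (x, ξ, 0) + c x ξ * V x - ρ * V x) (g := fun _ => 0)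
      (fun x hx => ?_) ?_ continuousOn_const hx
    · have h := le_ciSup (isCompact_range (hctrl x)).bddAbove ξ
      have h2 := hG x hx
      rw [Gop] at h2
      simp only [hA]
      linarith
    · exact hcont.comp (f := fun x : Vec d => (x, ξ)) (by fun_prop) fun x hx => ⟨hx, trivial⟩
  · have hproj : closure Q ⊆ Prod.fst '' {p : Vec d × K | p.1 ∈ closure Q ∧
        Aop σm b V (p.1, p.2, 0) + c p.1 p.2 * V p.1 - ρ * V p.1 = 0} := by
      refine closure_minimal (fun x hx => ?_) (hcompact.image continuous_fst).isClosed
      obtain ⟨ξ, hξ⟩ := (isCompact_range (hctrl x)).sSup_mem (range_nonempty _)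
      refine ⟨(x, ξ), ⟨subset_closure hx, ?_⟩, rfl⟩
      have h2 := hG x hx
      rw [Gop, iSup, ← hξ] at h2
      simp only [hA]
      linarith
    obtain ⟨p, hp, rfl⟩ := hproj hx
    exact ⟨p.2, hp.2⟩

/-- The extremal occupation measure: it is carried by the optimal controls and by
`y = ∇ log V(x)`. -/
theorem exists_extremal_measure [TopologicalSpace K] [CompactSpace K]
    [TopologicalSpace.MetrizableSpace K] [Nonempty K] [MeasurableSpace K] [BorelSpace K]
    {Q : Set (Vec d)} (hQo : IsOpen Q) (hQb : Bornology.IsBounded Q) (hQne : Q.Nonempty)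
    {Φd : Vec d → ℝ} (hΦd : ContDiff ℝ 2 Φd) (hQdef : Q = {x | Φd x < 0})
    (hQbd : frontier Q = {x | Φd x = 0}) (hΦgrad : ∀ x ∈ frontier Q, grad Φd x ≠ 0)
    {σm : Vec d → Matrix (Fin d) (Fin d) ℝ} {b : Vec d → K → Vec d} {c : Vec d → K → ℝ}
    (hσ : Continuous σm) (hb : Continuous fun p : Vec d × K => b p.1 p.2)
    (hc : Continuous fun p : Vec d × K => c p.1 p.2)
    (hell : ∃ θ > 0, ∀ x ∈ closure Q, ∀ v : Vec d,
      θ * (v ⬝ᵥ v) ≤ v ⬝ᵥ ((amat σm x) *ᵥ v))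
    {ρ : ℝ} {V : Vec d → ℝ} (hV : V ∈ C2gammaQ Q (conormal σm Φd))
    (hpos : ∀ x ∈ closure Q, 0 < V x) (hG : ∀ x ∈ Q, Gop σm b c V x = ρ * V x) :
    ∃ μ ∈ MQ K σm b Q (conormal σm Φd),
      Integrable (Rfun σm c) μ ∧ ∫ z, Rfun σm c z ∂μ = ρ := by
  let _ := TopologicalSpace.metrizableSpaceMetric K
  obtain ⟨-, hcompact, hex⟩ := eigenvalue_equation_closure hσ hb hc hQb hV hG
  set Z : Set (Vec d × K) := {p | p.1 ∈ closure Q ∧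
    Aop σm b V (p.1, p.2, 0) + c p.1 p.2 * V p.1 - ρ * V p.1 = 0} with hZ
  have : CompactSpace Z := isCompact_iff_compactSpace.1 hcompact
  have hlift : ∀ x ∈ closure Q, ∃ p : Z, p.1.1 = x := fun x hx =>
    let ⟨ξ, hξ⟩ := hex x hx
    ⟨⟨(x, ξ), hx, hξ⟩, rfl⟩
  have : Nonempty Z :=
    let ⟨x, hx⟩ := hQne
    (hlift x (subset_closure hx)).nonempty
  let e : Z → Zs d K := fun p => (p.1.1, p.1.2, (V p.1.1)⁻¹ • grad V p.1.1)
  have hfst : Continuous fun p : Z => p.1.1 := continuous_fst.comp continuous_subtype_val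
  have hsnd : Continuous fun p : Z => p.1.2 := continuous_snd.comp continuous_subtype_val
  have he : Continuous e := by
    refine hfst.prodMk (hsnd.prodMk (continuous_iff_continuousAt.2 fun p => ?_))
    have hVp := contDiffAt_of_mem_C2gammaQ hV p.2.1
    have h1 : ContinuousAt (fun p : Z => V p.1.1) p :=
      ContinuousAt.comp (g := V) hVp.continuousAt hfst.continuousAt
    have h2 : ContinuousAt (fun p : Z => grad V p.1.1) p :=
      ContinuousAt.comp (g := grad V) (continuousAt_grad hVp) hfst.continuousAt
    exact (h1.inv₀ (hpos _ p.2.1).ne').smul h2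
  have hemb : MeasurableEmbedding e :=
    (he.isClosedEmbedding fun p q hpq => Subtype.ext (Prod.ext (congrArg (fun z => z.1) hpq)
      (congrArg (fun z => z.2.1) hpq))).measurableEmbedding
  have hAc : ∀ f ∈ C2gammaQ Q (conormal σm Φd), Continuous fun p : Z => Aop σm b f (e p) :=
    fun f hf => continuous_iff_continuousAt.2 fun p =>
      ContinuousAt.comp (g := Aop σm b f)
        (continuousAt_Aop hσ hb (contDiffAt_of_mem_C2gammaQ hf p.2.1)) he.continuousAt
  let E : Submodule ℝ C(Z, ℝ) :=
    { carrier := {φ | ∃ f ∈ C2gammaQ Q (conormal σm Φd), ∀ p, φ p = Aop σm b f (e p)}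
      add_mem' := by
        rintro φ ψ ⟨f, hf, hφ⟩ ⟨g, hg, hψ⟩
        refine ⟨f + g, add_mem_C2gammaQ hf hg, fun p => ?_⟩
        rw [Aop_add σm b (contDiffAt_of_mem_C2gammaQ hf p.2.1)
          (contDiffAt_of_mem_C2gammaQ hg p.2.1), ContinuousMap.add_apply, hφ, hψ]
      zero_mem' := ⟨(0 : ℝ) • V, const_smul_mem_C2gammaQ 0 hV, fun p => by
        rw [Aop_const_smul, zero_mul, ContinuousMap.zero_apply]⟩
      smul_mem' := by
        rintro r φ ⟨f, hf, hφ⟩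
        refine ⟨r • f, const_smul_mem_C2gammaQ r hf, fun p => ?_⟩
        rw [Aop_const_smul, ContinuousMap.smul_apply, hφ, smul_eq_mul] }
  obtain ⟨μ, hμ, hμE⟩ := exists_isProbabilityMeasure_integral_eq_zero E (by
    rintro φ ⟨f, hf, hφ⟩
    obtain ⟨x, hx, hg, hH⟩ :=
      exists_critical_point_hess_nonneg hQo hQb hQne hΦd hQdef hQbd hΦgrad hell hf
    obtain ⟨p, rfl⟩ := hlift x hx
    refine ⟨p, ?_⟩
    rw [hφ, Aop]
    have h := trProd_amat_nonneg σm p.1.1 hH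
    simp only [e, hg, dotProduct_zero, add_zero]
    positivity)
  have hint : ∀ φ : Z → ℝ, Continuous φ → Integrable φ μ := fun φ hφ =>
    hφ.integrable_of_hasCompactSupport (HasCompactSupport.of_compactSpace φ)
  have hRA : ∀ p : Z, Rfun σm c (e p) =
      ρ - Aop σm b (fun x => Real.log (V x)) (e p) := by
    intro p
    have hv := (hpos _ p.2.1).ne'
    have h := Aop_log_add_Rfun σm b c (z := e p) (contDiffAt_of_mem_C2gammaQ hV p.2.1) hv
    have h2 := p.2.2
    have h3 : Aop σm b V (p.1.1, p.1.2, 0) = (ρ - c p.1.1 p.1.2) * V p.1.1 := by linarith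
    simp only [e, sub_self, Matrix.mulVec_zero, dotProduct_zero, mul_zero, sub_zero, h3] at h ⊢
    have h4 : (V p.1.1)⁻¹ * ((ρ - c p.1.1 p.1.2) * V p.1.1) = ρ - c p.1.1 p.1.2 := by
      field_simp
    linarith
  have hlog := log_mem_C2gammaQ hV hpos
  have hzero : ∀ f ∈ C2gammaQ Q (conormal σm Φd), ∫ p, Aop σm b f (e p) ∂μ = 0 :=
    fun f hf => hμE ⟨_, hAc f hf⟩ ⟨f, hf, fun _ => rfl⟩
  have hRe : Rfun σm c ∘ e = fun p => ρ - Aop σm b (fun x => Real.log (V x)) (e p) :=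
    funext hRA
  refine ⟨μ.map e, ⟨⟨Measure.isProbabilityMeasure_map hemb.measurable.aemeasurable, ?_⟩,
    fun f hf => ⟨?_, ?_⟩⟩, ?_, ?_⟩
  · rw [hemb.map_apply]
    convert measure_empty (μ := μ)
    exact eq_empty_of_forall_notMem fun p hp => hp p.2.1
  · exact hemb.integrable_map_iff.2 (hint _ (hAc f hf))
  · rw [hemb.integral_map]
    exact hzero f hf
  · rw [hemb.integrable_map_iff, hRe]
    exact (integrable_const ρ).sub (hint _ (hAc _ hlog))
  · rw [hemb.integral_map]
    simp only [hRA]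
    rw [integral_sub (integrable_const ρ) (hint _ (hAc _ hlog)), hzero _ hlog]
    simp

/-- Theorem 2.2: on a bounded `C²` domain `Q`, the Neumann
principal eigenvalue `ρ` of `𝒢` satisfies the saddle-point identity
`ρ = inf_g sup_μ F(g,μ) = sup_μ inf_g F(g,μ)`, where `g` ranges over
`C²_γ(Q̄)` and `μ` over `𝒫(Q̄×𝒦×ℝᵈ)`; moreover `𝒫(Q̄×𝒦×ℝᵈ)` may be replaced
by `ℳ_{𝒜,Q}`, and `ρ = sup_{μ ∈ ℳ_{𝒜,Q}} ∫ R dμ`. -/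
theorem bounded_domain_variational {d : ℕ} {K : Type*} [TopologicalSpace K]
    [CompactSpace K] [TopologicalSpace.MetrizableSpace K] [Nonempty K]
    [MeasurableSpace K] [BorelSpace K]
    (Q : Set (Vec d)) (hQo : IsOpen Q) (hQb : Bornology.IsBounded Q)
    (hQconn : IsConnected Q)
    -- `Q` is a `C²` domain with defining function `Φd`
    (Φd : Vec d → ℝ) (hΦd : ContDiff ℝ 2 Φd)
    (hQdef : Q = {x : Vec d | Φd x < 0})
    (hQbd : frontier Q = {x : Vec d | Φd x = 0})
    (hΦgrad : ∀ x ∈ frontier Q, grad Φd x ≠ 0)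
    (σm : Vec d → Matrix (Fin d) (Fin d) ℝ) (b : Vec d → K → Vec d)
    (c : Vec d → K → ℝ)
    -- the drift is continuous and Lipschitz in `x` uniformly in `ξ`
    (hb_cont : Continuous fun p : Vec d × K => b p.1 p.2)
    (hb_lip : ∃ C > 0, ∀ (ξ : K), ∀ x ∈ closure Q, ∀ y ∈ closure Q,
      nrm (b x ξ - b y ξ) ≤ C * nrm (x - y))
    -- `σ` is `C¹` with Hölder continuous derivatives
    (hσ_C1 : ∀ i j, ContDiff ℝ 1 fun x : Vec d => σm x i j)
    (hσ_holder : ∃ α > (0 : ℝ), α ≤ 1 ∧ ∃ C : ℝ, ∀ i j, ∀ x ∈ closure Q,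
      ∀ y ∈ closure Q, ‖fderiv ℝ (fun z : Vec d => σm z i j) x -
        fderiv ℝ (fun z : Vec d => σm z i j) y‖ ≤ C * nrm (x - y) ^ α)
    -- `a = σσᵀ` is nondegenerate on `Q`
    (hell : ∃ θ > 0, ∀ x ∈ closure Q, ∀ v : Vec d,
      θ * (v ⬝ᵥ v) ≤ v ⬝ᵥ ((amat σm x) *ᵥ v))
    -- the reward is continuous and Lipschitz in `x` uniformly in `ξ`
    (hc_cont : Continuous fun p : Vec d × K => c p.1 p.2)
    (hc_lip : ∃ C > 0, ∀ (ξ : K), ∀ x ∈ closure Q, ∀ y ∈ closure Q,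
      |c x ξ - c y ξ| ≤ C * nrm (x - y))
    -- `ρ` is the Neumann principal eigenvalue of `𝒢` on `Q`
    (ρ : ℝ)
    (hρ : ∃ V ∈ C2gammaQ Q (conormal σm Φd), (∀ x ∈ closure Q, 0 < V x) ∧
      ∀ x ∈ Q, Gop σm b c V x = ρ * V x) :
    ((ρ : EReal) =
      ⨅ g ∈ C2gammaQ Q (conormal σm Φd), ⨆ μ ∈ PQ K Q, Ffun σm b c g μ) ∧
    ((ρ : EReal) =
      ⨆ μ ∈ PQ K Q, ⨅ g ∈ C2gammaQ Q (conormal σm Φd), Ffun σm b c g μ) ∧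
    ((ρ : EReal) =
      ⨅ g ∈ C2gammaQ Q (conormal σm Φd),
        ⨆ μ ∈ MQ K σm b Q (conormal σm Φd), Ffun σm b c g μ) ∧
    ((ρ : EReal) =
      ⨆ μ ∈ MQ K σm b Q (conormal σm Φd),
        ⨅ g ∈ C2gammaQ Q (conormal σm Φd), Ffun σm b c g μ) ∧
    ((ρ : EReal) =
      ⨆ μ ∈ MQ K σm b Q (conormal σm Φd), integralE μ (Rfun σm c)) := by
  obtain ⟨V, hV, hpos, hG⟩ := hρ
  have hσ : Continuous σm :=
    continuous_pi fun i => continuous_pi fun j => (hσ_C1 i j).continuous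
  set γv := conormal σm Φd
  set w : Vec d → ℝ := fun x => Real.log (V x)
  have hlog : w ∈ C2gammaQ Q γv := log_mem_C2gammaQ hV hpos
  obtain ⟨μs, hμs, hRint, hRρ⟩ := exists_extremal_measure hQo hQb hQconn.nonempty hΦd hQdef
    hQbd hΦgrad hσ hb_cont hc_cont hell hV hpos hG
  have hle : ∀ z : Zs d K, z.1 ∈ closure Q → Aop σm b w z + Rfun σm c z ≤ ρ := by
    intro z hz
    have hv := hpos _ hz
    rw [Aop_log_add_Rfun σm b c (contDiffAt_of_mem_C2gammaQ hV hz) hv.ne']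
    have h1 := (eigenvalue_equation_closure hσ hb_cont hc_cont hQb hV hG).1 z.1 hz z.2.1
    have h2 := dotProduct_self_nonneg
      ((σm z.1)ᵀ *ᵥ (z.2.2 - (V z.1)⁻¹ • grad V z.1))
    have h3 : (V z.1)⁻¹ * Aop σm b V (z.1, z.2.1, 0) ≤ ρ - c z.1 z.2.1 := by
      rw [inv_mul_le_iff₀ hv]
      linarith
    linarith
  have hle_ae : ∀ μ ∈ PQ K Q, ∀ᵐ z ∂μ, Aop σm b w z + Rfun σm c z ≤ ρ := by
    intro μ hμ
    have h : ∀ᵐ z ∂μ, z.1 ∈ closure Q := hμ.2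
    exact h.mono hle
  have hF_le : ∀ μ ∈ PQ K Q, Ffun σm b c w μ ≤ ρ := by
    intro μ hμ
    have := hμ.1
    refine (integralE_mono_ae (hle_ae μ hμ)).trans_eq ?_
    rw [integralE_eq_integral (integrable_const ρ)]
    simp
  have hR_le : ∀ μ ∈ MQ K σm b Q γv, integralE μ (Rfun σm c) ≤ ρ := by
    intro μ hμ
    have := hμ.1.1
    have hA := hμ.2 w hlog
    have h : ∀ᵐ z ∂μ, Rfun σm c z ≤ ρ - Aop σm b w z :=
      (hle_ae μ hμ.1).mono fun z hz => by linarith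
    refine (integralE_mono_ae h).trans_eq ?_
    rw [integralE_eq_integral (f := fun z => ρ - Aop σm b w z) ((integrable_const ρ).sub hA.1),
      integral_sub (integrable_const ρ) hA.1, hA.2]
    simp
  have hF_eq : ∀ g ∈ C2gammaQ Q γv, Ffun σm b c g μs = ρ := by
    intro g hg
    have hA := hμs.2 g hg
    rw [Ffun, integralE_eq_integral (f := fun z => Aop σm b g z + Rfun σm c z)
      (hA.1.add hRint), integral_add hA.1 hRint, hA.2, hRρ,
      zero_add]
  have hsub : MQ K σm b Q γv ⊆ PQ K Q := fun μ hμ => hμ.1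
  have hsaddle : ∀ P ⊆ PQ K Q, μs ∈ P →
      ((ρ : EReal) = ⨅ g ∈ C2gammaQ Q γv, ⨆ μ ∈ P, Ffun σm b c g μ) ∧
      ((ρ : EReal) = ⨆ μ ∈ P, ⨅ g ∈ C2gammaQ Q γv, Ffun σm b c g μ) := by
    intro P hP hμP
    refine ⟨le_antisymm ?_ ?_, le_antisymm ?_ ?_⟩
    · exact le_iInf₂ fun g hg =>
        (hF_eq g hg).ge.trans (le_iSup₂ (f := fun μ _ => Ffun σm b c g μ) μs hμP)
    · exact (iInf₂_le w hlog).trans (iSup₂_le fun μ hμ => hF_le μ (hP hμ))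
    · exact (le_iInf₂ fun g hg => (hF_eq g hg).ge).trans
        (le_iSup₂ (f := fun μ _ => ⨅ g ∈ C2gammaQ Q γv, Ffun σm b c g μ) μs hμP)
    · exact iSup₂_le fun μ hμ => (iInf₂_le w hlog).trans (hF_le μ (hP hμ))
  obtain ⟨h1, h2⟩ := hsaddle _ subset_rfl (hsub hμs)
  obtain ⟨h3, h4⟩ := hsaddle _ hsub hμs
  refine ⟨h1, h2, h3, h4, le_antisymm ?_ (iSup₂_le hR_le)⟩
  have h := integralE_eq_integral hRint
  rw [hRρ] at h
  exact h.ge.trans (le_iSup₂ (f := fun μ _ => integralE μ (Rfun σm c)) μs hμs)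

end RS
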